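/- arXiv:2407.09580 — 2 statements merged into one kernel-verified Lean document; each statement's English description precedes it below -/
import Mathlib

section
/- Let ρ : ℝ → ℝ be real analytic and non-polynomial on an open interval (α, β) with α < β. Let f : [0,1] → ℝ, let ε > 0, and let K be a positive integer such that |f(x_1) − f(x_2)| < ε/2 whenever x_1, x_2 ∈ [0,1] and |x_1 − x_2| < 1/K. Then there exist real numbers u, v, w, w_0 such that the function φ(x) := u·g( w·ρ( (α+β)/2 + (ψ(2Kx)/2 + 1)·w_0 ) ) + v satisfies |φ(x) − f(x)| < ε for every x in the union over k = 0, 1, …, K−1 of the intervals [2k/(2K), (2k+1)/(2K)]. -/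
open Set

/-- The 2-periodic triangle wave `g(x) = |x - 2⌊(x+1)/2⌋|`. -/
noncomputable def triWave (x : ℝ) : ℝ := |x - 2 * (⌊(x + 1) / 2⌋ : ℤ)|

/-- `ψ(x) = x - g(x)`. -/
noncomputable def psiFun (x : ℝ) : ℝ := x - triWave x

lemma triWave_le (x : ℝ) (m : ℤ) : triWave x ≤ |x - 2 * m| := by
  have h := round_le (x / 2) m
  have e : (x + 1) / 2 = x / 2 + 1 / 2 := by ring
  rw [triWave, e, ← round_eq]
  have h1 : x - 2 * (round (x / 2) : ℝ) = 2 * (x / 2 - round (x / 2)) := by ring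
  have h2 : x - 2 * (m : ℝ) = 2 * (x / 2 - m) := by ring
  rw [h1, h2, abs_mul, abs_mul]
  gcongr

lemma triWave_lip_aux (x y : ℝ) (m : ℤ) : triWave x - triWave y ≤ |x - y - 2 * m| := by
  have h := triWave_le x (m + ⌊(y + 1) / 2⌋)
  have h2 : triWave y = |y - 2 * (⌊(y + 1) / 2⌋ : ℤ)| := rfl
  have h3 := abs_add_le (x - y - 2 * m) (y - 2 * (⌊(y + 1) / 2⌋ : ℤ))
  have h4 : x - y - 2 * m + (y - 2 * (⌊(y + 1) / 2⌋ : ℤ)) = x - 2 * ((m + ⌊(y + 1) / 2⌋ : ℤ) : ℝ) := by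
    push_cast; ring
  rw [h4] at h3
  linarith

lemma triWave_lip (x y : ℝ) (m : ℤ) : |triWave x - triWave y| ≤ |x - y - 2 * m| := by
  rw [abs_le]
  have h1 := triWave_lip_aux x y m
  have h2 := triWave_lip_aux y x (-m)
  have h3 : |y - x - 2 * ((-m : ℤ) : ℝ)| = |x - y - 2 * m| := by
    rw [← abs_neg]; congr 1; push_cast; ring
  constructor <;> linarith

lemma triWave_of_mem (k : ℤ) (y : ℝ) (h0 : 0 ≤ y) (h1 : y ≤ 1) : triWave (2 * k + y) = y := by
  rcases h1.lt_or_eq with h | rfl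
  · have : ⌊(2 * (k : ℝ) + y + 1) / 2⌋ = k := by
      rw [Int.floor_eq_iff]; constructor <;> linarith
    rw [triWave, this]; simp [abs_of_nonneg h0]
  · have : ⌊(2 * (k : ℝ) + 1 + 1) / 2⌋ = k + 1 := by
      rw [Int.floor_eq_iff]; push_cast; constructor <;> linarith
    rw [triWave, this]; push_cast; ring_nf; norm_num

lemma close_of_cos (s η : ℝ) (h0 : 0 < η) 
    (h : Real.cos (Real.pi * η / 2) < |Real.cos (Real.pi * s / 2)|) : ∃ m : ℤ, |s - 2 * m| < η := by
  refine ⟨round (s / 2), ?_⟩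
  set m := round (s / 2) with hm
  have hr : |s - 2 * m| ≤ 1 := by
    have := abs_sub_round (s / 2)
    rw [← hm] at this
    have e : s - 2 * (m : ℝ) = 2 * (s / 2 - m) := by ring
    rw [e, abs_mul, abs_two]; linarith
  set r := s - 2 * (m : ℝ) with hrdef
  have e : Real.pi * s / 2 = Real.pi * r / 2 + m * Real.pi := by rw [hrdef]; ring
  have hpi := Real.pi_pos
  have e2 : |Real.cos (Real.pi * s / 2)| = Real.cos (Real.pi * |r| / 2) := by
    rw [e, Real.cos_add_int_mul_pi, abs_mul]
    have : |((-1 : ℝ)) ^ m| = 1 := by simp [abs_zpow]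
    rw [this, one_mul]
    have e3 : Real.pi * |r| / 2 = |Real.pi * r / 2| := by
      rw [abs_div, abs_mul, abs_of_pos hpi, abs_two]
    rw [e3, Real.cos_abs, abs_of_nonneg]
    rw [abs_le] at hr
    apply Real.cos_nonneg_of_neg_pi_div_two_le_of_le <;> nlinarith
  rw [e2] at h
  by_contra hc
  push Not at hc
  have := Real.cos_le_cos_of_nonneg_of_le_pi (x := Real.pi * η / 2) (y := Real.pi * |r| / 2)
    (by positivity) (by nlinarith) (by nlinarith)
  linarith

lemma norm_half (s : ℝ) : ‖(1 + Complex.exp ((Real.pi * s : ℝ) * Complex.I)) / 2‖ = |Real.cos (Real.pi * s / 2)| := by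
  have : (1 + Complex.exp ((Real.pi * s : ℝ) * Complex.I)) / 2
      = Complex.exp ((Real.pi * s / 2 : ℝ) * Complex.I) * (Real.cos (Real.pi * s / 2) : ℝ) := by
    rw [Complex.ofReal_cos, Complex.cos, mul_div_assoc', mul_add, ← Complex.exp_add, ← Complex.exp_add]
    congr 1
    rw [add_comm]
    congr 1
    · congr 1; push_cast; ring
    · rw [← Complex.exp_zero]; congr 1; push_cast; ring
  rw [this, norm_mul, Complex.norm_exp_ofReal_mul_I, one_mul, Complex.norm_real, Real.norm_eq_abs]

/-- mean of an exponential -/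
lemma mean_exp (θ : ℝ) (hθ : θ ≠ 0) : Filter.Tendsto
    (fun T : ℝ => (T : ℂ)⁻¹ * ∫ w in (0 : ℝ)..T, Complex.exp ((θ * w : ℝ) * Complex.I)) Filter.atTop (nhds 0) := by
  have hc : (θ : ℂ) * Complex.I ≠ 0 := by simp [hθ]
  have e : ∀ w : ℝ, Complex.exp ((θ * w : ℝ) * Complex.I) = Complex.exp ((θ * Complex.I) * w) := by
    intro w; congr 1; push_cast; ring
  simp_rw [e, integral_exp_mul_complex hc]
  rw [tendsto_zero_iff_norm_tendsto_zero]
  have hlim : Filter.Tendsto (fun T : ℝ => T⁻¹ * (2 / |θ|)) Filter.atTop (nhds 0) := by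
    simpa using tendsto_inv_atTop_zero.mul_const (2 / |θ|)
  refine squeeze_zero' (Filter.Eventually.of_forall fun _ => norm_nonneg _) ?_ hlim
  filter_upwards [Filter.eventually_gt_atTop 0] with T hT
  rw [norm_mul, norm_inv, Complex.norm_real, Real.norm_of_nonneg hT.le, norm_div]
  have : ‖(θ : ℂ) * Complex.I‖ = |θ| := by simp
  rw [this]
  gcongr
  refine (norm_sub_le _ _).trans ?_
  rw [← e, ← e, Complex.norm_exp_ofReal_mul_I, Complex.norm_exp_ofReal_mul_I]; norm_num

lemma coeff_bound {ι : Type*} [DecidableEq ι] (S : Finset ι) (c : ι → ℂ) (θ : ι → ℝ) (hθ : Function.Injective θ)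
    (M : ℝ) (hM : ∀ w : ℝ, ‖∑ n ∈ S, c n * Complex.exp ((θ n * w : ℝ) * Complex.I)‖ ≤ M) (n₀ : ι)
    (hn₀ : n₀ ∈ S) : ‖c n₀‖ ≤ M := by
  have key : Filter.Tendsto (fun T : ℝ => (T : ℂ)⁻¹ * ∫ w in (0 : ℝ)..T,
      ∑ n ∈ S, c n * Complex.exp (((θ n - θ n₀) * w : ℝ) * Complex.I)) Filter.atTop (nhds (c n₀)) := by
    have h1 : ∀ n ∈ S, Filter.Tendsto (fun T : ℝ => c n * ((T : ℂ)⁻¹ * ∫ w in (0 : ℝ)..T,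
        Complex.exp (((θ n - θ n₀) * w : ℝ) * Complex.I))) Filter.atTop (nhds (if n = n₀ then c n else 0)) := by
      intro n _
      split_ifs with h
      · subst h
        apply tendsto_const_nhds.congr'
        filter_upwards [Filter.eventually_gt_atTop 0] with T hT
        have : (T : ℂ) ≠ 0 := by exact_mod_cast hT.ne'
        simp [this]
      · simpa using (mean_exp (θ n - θ n₀) (sub_ne_zero.2 fun h' => h (hθ h'))).const_mul (c n)
    have h2 := tendsto_finsetSum S h1
    rw [Finset.sum_ite_eq' S n₀ c, if_pos hn₀] at h2
    refine h2.congr fun T => ?_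
    rw [intervalIntegral.integral_finsetSum]
    · rw [Finset.mul_sum]
      refine Finset.sum_congr rfl fun n _ => ?_
      rw [intervalIntegral.integral_const_mul]; ring
    · intro n _
      apply Continuous.intervalIntegrable
      fun_prop
  refine le_of_tendsto key.norm ?_
  filter_upwards [Filter.eventually_gt_atTop 0] with T hT
  rw [norm_mul, norm_inv, Complex.norm_real, Real.norm_of_nonneg hT.le]
  have : ‖∫ w in (0 : ℝ)..T, ∑ n ∈ S, c n * Complex.exp (((θ n - θ n₀) * w : ℝ) * Complex.I)‖ ≤ M * |T - 0| := by
    apply intervalIntegral.norm_integral_le_of_norm_le_const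
    intro w _
    have e : ∑ n ∈ S, c n * Complex.exp (((θ n - θ n₀) * w : ℝ) * Complex.I)
        = (∑ n ∈ S, c n * Complex.exp ((θ n * w : ℝ) * Complex.I)) * Complex.exp ((-(θ n₀ * w) : ℝ) * Complex.I) := by
      rw [Finset.sum_mul]
      refine Finset.sum_congr rfl fun n _ => ?_
      rw [mul_assoc, ← Complex.exp_add]
      congr 2; push_cast; ring
    rw [e, norm_mul, Complex.norm_exp_ofReal_mul_I, mul_one]
    exact hM w
  rw [sub_zero, abs_of_pos hT] at this
  rw [inv_mul_le_iff₀ hT]; linarith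

lemma kronecker {K : ℕ} (a y : Fin K → ℝ)
    (ha : Function.Injective fun n : Fin K → ℕ => ∑ k, (n k : ℝ) * a k)
    (δ : ℝ) (h0 : 0 ≤ δ) (h1 : δ < 1) :
    ∃ w : ℝ, ∀ k, δ < |Real.cos (Real.pi * (w * a k - y k) / 2)| := by
  by_contra hcon
  push Not at hcon
  let q : ℕ → ℕ → ℝ := fun N j => (N.choose j : ℝ) / 2 ^ N
  let c : ℕ → (Fin K → ℕ) → ℂ := fun N n =>
    ∏ k, ((q N (n k) : ℝ) : ℂ) * Complex.exp ((-(Real.pi * (n k * y k)) : ℝ) * Complex.I)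
  have hqsum : ∀ N, ∑ j ∈ Finset.range (N + 1), q N j = 1 := by
    intro N
    simp only [q]
    rw [← Finset.sum_div, ← Nat.cast_sum, Nat.sum_range_choose]; simp
  have hcn : ∀ N n, ‖c N n‖ = ∏ k, q N (n k) := by
    intro N n
    simp only [c]
    rw [norm_prod]
    refine Finset.prod_congr rfl fun k _ => ?_
    rw [norm_mul, Complex.norm_exp_ofReal_mul_I, mul_one, Complex.norm_real, Real.norm_of_nonneg]
    positivity
  let S : ℕ → Finset (Fin K → ℕ) := fun N => Fintype.piFinset fun _ => Finset.range (N + 1)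
  have hsum : ∀ N, ∑ n ∈ S N, ‖c N n‖ = 1 := by
    intro N
    simp_rw [hcn, S]
    rw [← Finset.prod_univ_sum (fun _ : Fin K => Finset.range (N + 1)) (fun _ j => q N j)]
    simp [hqsum]
  have hbd : ∀ N, ∀ n ∈ S N, ‖c N n‖ ≤ δ ^ N := by
    intro N n hn
    refine coeff_bound (S N) (c N) (fun n => Real.pi * ∑ k, (n k : ℝ) * a k) ?_ _ ?_ n hn
    · intro n n' h
      exact ha (mul_left_cancel₀ Real.pi_ne_zero h)
    · intro w
      have e : ∑ n ∈ S N, c N n * Complex.exp ((Real.pi * (∑ k, (n k : ℝ) * a k) * w : ℝ) * Complex.I)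
          = ∏ k, ((1 + Complex.exp ((Real.pi * (w * a k - y k) : ℝ) * Complex.I)) / 2) ^ N := by
        have e1 : ∀ k, ((1 + Complex.exp ((Real.pi * (w * a k - y k) : ℝ) * Complex.I)) / 2) ^ N
            = ∑ j ∈ Finset.range (N + 1), ((q N j : ℝ) : ℂ) *
              Complex.exp ((-(Real.pi * (j * y k)) : ℝ) * Complex.I) *
              Complex.exp ((Real.pi * (j * a k) * w : ℝ) * Complex.I) := by
          intro k
          rw [div_pow, add_comm (1 : ℂ), add_pow, Finset.sum_div]
          refine Finset.sum_congr rfl fun j _ => ?_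
          rw [← Complex.exp_nat_mul]
          simp only [q]
          have : (j : ℂ) * ((Real.pi * (w * a k - y k) : ℝ) * Complex.I) =
            (-(Real.pi * (j * y k)) : ℝ) * Complex.I + (Real.pi * (j * a k) * w : ℝ) * Complex.I := by
            push_cast; ring
          rw [this, Complex.exp_add, one_pow]
          push_cast
          ring
        simp_rw [e1]
        rw [Finset.prod_univ_sum]
        refine Finset.sum_congr rfl fun n _ => ?_
        rw [Finset.prod_mul_distrib]
        congr 1
        rw [← Complex.exp_sum, ← Finset.sum_mul, ← Complex.ofReal_sum, ← Finset.sum_mul, ← Finset.mul_sum]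
      rw [e, norm_prod]
      obtain ⟨k, hk⟩ := hcon w
      rw [← Finset.mul_prod_erase _ _ (Finset.mem_univ k)]
      have b1 : ‖((1 + Complex.exp ((Real.pi * (w * a k - y k) : ℝ) * Complex.I)) / 2) ^ N‖ ≤ δ ^ N := by
        rw [norm_pow, norm_half]
        gcongr
      have b2 : ∏ k' ∈ Finset.univ.erase k,
          ‖((1 + Complex.exp ((Real.pi * (w * a k' - y k') : ℝ) * Complex.I)) / 2) ^ N‖ ≤ 1 := by
        apply Finset.prod_le_one
        · intros; positivity
        · intro i _
          rw [norm_pow, norm_half]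
          exact pow_le_one₀ (abs_nonneg _) (Real.abs_cos_le_one _)
      calc _ ≤ δ ^ N * 1 := by gcongr
        _ = _ := mul_one _
  have hfin : ∀ N : ℕ, (1 : ℝ) ≤ ((N + 1 : ℕ) : ℝ) ^ K * δ ^ N := by
    intro N
    calc (1 : ℝ) = ∑ n ∈ S N, ‖c N n‖ := (hsum N).symm
      _ ≤ ∑ n ∈ S N, δ ^ N := Finset.sum_le_sum (hbd N)
      _ = _ := by
        rw [Finset.sum_const, nsmul_eq_mul]
        simp [S]
  have hlim := (tendsto_pow_const_mul_const_pow_of_lt_one K h0 h1)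
  have hle : ∀ N : ℕ, δ ≤ ((N + 1 : ℕ) : ℝ) ^ K * δ ^ (N + 1) := by
    intro N
    have := mul_le_mul_of_nonneg_right (hfin N) h0
    rw [pow_succ]; linarith
  have h2 := ge_of_tendsto' ((Filter.tendsto_add_atTop_iff_nat 1).2 hlim) hle
  have hδ : δ = 0 := le_antisymm h2 h0
  have := hfin 1
  simp [hδ] at this
  linarith


lemma lam_zero {K : ℕ} (l : Fin K → ℝ)
    (h : ∃ᶠ n : ℕ in Filter.atTop, ∑ k, l k * ((k : ℝ) + 1) ^ n = 0) : l = 0 := by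
  by_contra hne
  have hex : (Finset.univ.filter fun k => l k ≠ 0).Nonempty := by
    obtain ⟨k, hk⟩ := Function.ne_iff.1 hne
    exact ⟨k, by simpa using hk⟩
  obtain ⟨m, hm, hmax⟩ := Finset.exists_max_image _ (fun k : Fin K => k) hex
  simp only [Finset.mem_filter, Finset.mem_univ, true_and] at hm hmax
  have hlim : Filter.Tendsto (fun n : ℕ => ∑ k, l k * (((k : ℝ) + 1) / ((m : ℝ) + 1)) ^ n)
      Filter.atTop (nhds (∑ k, if k = m then l k else 0)) := by
    apply tendsto_finsetSum
    intro k _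
    split_ifs with hk
    · subst hk
      have : ((k : ℝ) + 1) / ((k : ℝ) + 1) = 1 := div_self (by positivity)
      simp [this]
    · by_cases hl : l k = 0
      · simp [hl]
      · have hlt : k < m := lt_of_le_of_ne (hmax k hl) hk
        have hlt' : (k : ℝ) < m := by exact_mod_cast hlt
        have := (tendsto_pow_atTop_nhds_zero_of_lt_one (r := ((k : ℝ) + 1) / ((m : ℝ) + 1))
          (by positivity) (by rw [div_lt_one (by positivity)]; linarith)).const_mul (l k)
        simpa using this
  rw [Finset.sum_ite_eq' Finset.univ m l, if_pos (Finset.mem_univ m)] at hlim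
  have hfr : ∃ᶠ n : ℕ in Filter.atTop, ∑ k, l k * (((k : ℝ) + 1) / ((m : ℝ) + 1)) ^ n ∈ ({0} : Set ℝ) := by
    refine h.mono fun n hn => ?_
    have : ∑ k, l k * (((k : ℝ) + 1) / ((m : ℝ) + 1)) ^ n
        = (∑ k, l k * ((k : ℝ) + 1) ^ n) / ((m : ℝ) + 1) ^ n := by
      rw [Finset.sum_div]
      refine Finset.sum_congr rfl fun k _ => ?_
      rw [div_pow, mul_div_assoc]
    rw [this, hn]; simp
  have := isClosed_singleton.mem_of_frequently_of_tendsto hfr hlim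
  exact hm this

lemma lam_zero_of_eventually (ρ : ℝ → ℝ) (α β : ℝ) (c : ℝ) (hc : c ∈ Ioo α β)
    (hanal : AnalyticOnNhd ℝ ρ (Ioo α β))
    (hnonpoly : ¬ ∃ p : Polynomial ℝ, ∀ x ∈ Ioo α β, ρ x = p.eval x)
    {K : ℕ} (l : Fin K → ℝ)
    (h : ∀ᶠ t in nhds (0 : ℝ), ∑ k, l k * ρ (c + ((k : ℝ) + 1) * t) = 0) : l = 0 := by
  obtain ⟨p, hp⟩ := hanal c hc
  rw [hasFPowerSeriesAt_iff] at hp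
  have hcoef : ∀ n, p.coeff n * ∑ k, l k * ((k : ℝ) + 1) ^ n = 0 := by
    have hz : HasFPowerSeriesAt (0 : ℝ → ℝ) (FormalMultilinearSeries.ofScalars ℝ
        fun n => p.coeff n * ∑ k, l k * ((k : ℝ) + 1) ^ n) 0 := by
      rw [hasFPowerSeriesAt_iff]
      have hk : ∀ k : Fin K, ∀ᶠ t in nhds (0 : ℝ),
          HasSum (fun n => (((k : ℝ) + 1) * t) ^ n • p.coeff n) (ρ (c + ((k : ℝ) + 1) * t)) := by
        intro k
        have : Filter.Tendsto (fun t : ℝ => ((k : ℝ) + 1) * t) (nhds 0) (nhds 0) := by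
          have : Continuous (fun t : ℝ => ((k : ℝ) + 1) * t) := by fun_prop
          simpa using this.tendsto 0
        exact this.eventually hp
      filter_upwards [h, Filter.eventually_all.2 hk] with t ht hkt
      have hs := hasSum_sum (s := Finset.univ) fun (k : Fin K) _ => (hkt k).mul_left (l k)
      rw [ht] at hs
      simp only [FormalMultilinearSeries.coeff_ofScalars, Pi.zero_apply]
      have hfun : (fun n => t ^ n • (p.coeff n * ∑ k, l k * ((k : ℝ) + 1) ^ n))
          = fun n => ∑ k, l k * ((((k : ℝ) + 1) * t) ^ n • p.coeff n) := by
        funext n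
        rw [smul_eq_mul, Finset.mul_sum, Finset.mul_sum]
        refine Finset.sum_congr rfl fun k _ => ?_
        rw [smul_eq_mul, mul_pow]; ring
      rw [hfun]
      exact hs
    have := hz.eq_zero
    intro n
    have h2 := congrArg (fun q => FormalMultilinearSeries.coeff q n) this
    simp only [FormalMultilinearSeries.coeff_ofScalars] at h2
    rw [h2]
    simp [FormalMultilinearSeries.coeff]
  apply lam_zero
  by_contra hfr
  rw [Filter.not_frequently, Filter.eventually_atTop] at hfr
  obtain ⟨N, hN⟩ := hfr
  have hpz : ∀ n, N ≤ n → p.coeff n = 0 := fun n hn =>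
    (mul_eq_zero.1 (hcoef n)).resolve_right (hN n hn)
  apply hnonpoly
  let P : Polynomial ℝ := ∑ n ∈ Finset.range N, Polynomial.C (p.coeff n) * (Polynomial.X - Polynomial.C c) ^ n
  refine ⟨P, ?_⟩
  have hPan : AnalyticOnNhd ℝ (fun x => P.eval x) (Ioo α β) := by
    have := AnalyticOnNhd.aeval_polynomial (A := ℝ) (s := Ioo α β) (f := fun x : ℝ => x) (𝕜 := ℝ) analyticOnNhd_id P
    simpa using this
  refine AnalyticOnNhd.eqOn_of_preconnected_of_eventuallyEq hanal hPan isPreconnected_Ioo hc ?_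
  have ht : Filter.Tendsto (fun x : ℝ => x - c) (nhds c) (nhds 0) := by
    have : Continuous (fun x : ℝ => x - c) := by fun_prop
    simpa using this.tendsto c
  filter_upwards [ht.eventually hp] with x hx
  have h1 : HasSum (fun n => (x - c) ^ n • p.coeff n) (∑ n ∈ Finset.range N, (x - c) ^ n • p.coeff n) := by
    apply hasSum_sum_of_ne_finset_zero
    intro n hn
    rw [hpz n (by simpa using hn), smul_zero]
  have h2 := hx.unique h1
  rw [add_sub_cancel] at h2
  rw [h2]
  simp only [P, Polynomial.eval_finsetSum]
  refine Finset.sum_congr rfl fun n _ => ?_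
  simp [mul_comm]

lemma countable_zeros (G : ℝ → ℝ) (r : ℝ) (hr : 0 < r) (hG : AnalyticOnNhd ℝ G (Ioo (-r) r))
    (hne : ¬ ∀ᶠ t in nhds (0 : ℝ), G t = 0) : {t | t ∈ Ioo (-r) r ∧ G t = 0}.Countable := by
  refine (countable_setOfPred_isolated_right_within (s := {t | t ∈ Ioo (-r) r ∧ G t = 0})).mono ?_
  rintro t ⟨ht, ht0⟩
  refine ⟨⟨ht, ht0⟩, ?_⟩
  rcases (hG t ht).eventually_eq_zero_or_eventually_ne_zero with h | h
  · exfalso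
    apply hne
    have := hG.eqOn_zero_of_preconnected_of_eventuallyEq_zero isPreconnected_Ioo ht h
    filter_upwards [Ioo_mem_nhds (neg_lt_zero.2 hr) hr] with s hs using this hs
  · have h' : ∀ᶠ z in nhdsWithin t ({t | t ∈ Ioo (-r) r ∧ G t = 0} ∩ Ioi t), G z ≠ 0 :=
      h.filter_mono (nhdsWithin_mono _ fun z hz => ne_of_gt hz.2)
    have h'' : ∀ᶠ z in nhdsWithin t ({t | t ∈ Ioo (-r) r ∧ G t = 0} ∩ Ioi t), False := by
      filter_upwards [h', self_mem_nhdsWithin] with z hz hz' using hz hz'.1.2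
    simpa using h''

lemma exists_indep (ρ : ℝ → ℝ) (α β : ℝ) (hαβ : α < β)
    (hanal : AnalyticOnNhd ℝ ρ (Ioo α β))
    (hnonpoly : ¬ ∃ p : Polynomial ℝ, ∀ x ∈ Ioo α β, ρ x = p.eval x) (K : ℕ) :
    ∃ w₀ : ℝ, Function.Injective
      fun n : Fin K → ℕ => ∑ k, (n k : ℝ) * ρ ((α + β) / 2 + ((k : ℝ) + 1) * w₀) := by
  set c := (α + β) / 2 with hcdef
  have hc : c ∈ Ioo α β := by constructor <;> linarith
  set r := (β - α) / 2 / (K + 1) with hrdef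
  have hr : 0 < r := by
    have : 0 < β - α := by linarith
    positivity
  have hrK : r * (K + 1) = (β - α) / 2 := by rw [hrdef]; field_simp
  let G : (Fin K → ℤ) → ℝ → ℝ := fun l t => ∑ k, (l k : ℝ) * ρ (c + ((k : ℝ) + 1) * t)
  have hG : ∀ l, AnalyticOnNhd ℝ (G l) (Ioo (-r) r) := by
    intro l t ht
    simp only [G]
    apply Finset.analyticAt_fun_sum
    intro k _
    apply analyticAt_const.mul
    have hmem : c + ((k : ℝ) + 1) * t ∈ Ioo α β := by
      have hk : (k : ℝ) + 1 ≤ K + 1 := by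
        have : (k : ℝ) < K := by exact_mod_cast k.2
        linarith
      have hk0 : (0 : ℝ) < (k : ℝ) + 1 := by positivity
      have h1 : ((k : ℝ) + 1) * t < ((k : ℝ) + 1) * r := by gcongr; exact ht.2
      have h2 : ((k : ℝ) + 1) * (-r) < ((k : ℝ) + 1) * t := by gcongr; exact ht.1
      have h3 : ((k : ℝ) + 1) * r ≤ (K + 1) * r := by gcongr
      constructor <;> linarith
    exact AnalyticAt.fun_comp (hanal _ hmem) (by fun_prop)
  have hbad : (⋃ l : {l : Fin K → ℤ // l ≠ 0}, {t | t ∈ Ioo (-r) r ∧ G l t = 0}).Countable := by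
    apply countable_iUnion
    rintro ⟨l, hl⟩
    apply countable_zeros _ r hr (hG l)
    intro h
    apply hl
    have := lam_zero_of_eventually ρ α β c hc hanal hnonpoly (fun k => (l k : ℝ)) h
    funext k
    have := congrFun this k
    simpa using this
  obtain ⟨t, htr, ht⟩ := (hbad.dense_compl ℝ).inter_open_nonempty _ isOpen_Ioo
    (nonempty_Ioo.2 (by linarith : -r < r))
  refine ⟨t, fun n n' h => ?_⟩
  by_contra hnn
  apply ht
  refine mem_iUnion.2 ⟨⟨fun k => (n k : ℤ) - n' k, ?_⟩, htr, ?_⟩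
  · intro h0
    apply hnn
    funext k
    have := congrFun h0 k
    simp only [Pi.zero_apply] at this
    omega
  · simp only [G]
    have h' : ∑ k, (n k : ℝ) * ρ (c + ((k : ℝ) + 1) * t) - ∑ k, (n' k : ℝ) * ρ (c + ((k : ℝ) + 1) * t) = 0 :=
      sub_eq_zero.2 h
    rw [← Finset.sum_sub_distrib] at h'
    rw [← h']
    refine Finset.sum_congr rfl fun k _ => ?_
    push_cast; ring

/-- **Approximation on half of the intervals.** If `ρ` is real analytic and non-polynomial
on `(α, β)` and `f` satisfies `|f(x₁) - f(x₂)| < ε/2` whenever `x₁, x₂ ∈ [0,1]` with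
`|x₁ - x₂| < 1/K`, then there are reals `u, v, w, w₀` such that
`φ(x) = u·g(w·ρ((α+β)/2 + (ψ(2Kx)/2 + 1)·w₀)) + v` satisfies `|φ(x) - f(x)| < ε` on
`⋃_{k=0}^{K-1} [2k/(2K), (2k+1)/(2K)]`. -/
theorem approx_on_half_intervals
    (ρ : ℝ → ℝ) (α β : ℝ) (hαβ : α < β)
    (hanal : AnalyticOnNhd ℝ ρ (Ioo α β))
    (hnonpoly : ¬ ∃ p : Polynomial ℝ, ∀ x ∈ Ioo α β, ρ x = p.eval x)
    (f : ℝ → ℝ) (ε : ℝ) (hε : 0 < ε) (K : ℕ) (hK : 0 < K)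
    (hf : ∀ x₁ ∈ Icc (0 : ℝ) 1, ∀ x₂ ∈ Icc (0 : ℝ) 1,
      |x₁ - x₂| < 1 / K → |f x₁ - f x₂| < ε / 2) :
    ∃ u v w w₀ : ℝ,
      ∀ x ∈ ⋃ k ∈ Finset.range K,
          Icc ((2 * (k : ℝ)) / (2 * K)) ((2 * (k : ℝ) + 1) / (2 * K)),
        |u * triWave (w * ρ ((α + β) / 2 + (psiFun (2 * K * x) / 2 + 1) * w₀)) + v - f x|
          < ε := by
  obtain ⟨w₀, hw₀⟩ := exists_indep ρ α β hαβ hanal hnonpoly K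
  have hKr : (0 : ℝ) < K := by exact_mod_cast hK
  let y : Fin K → ℝ := fun k => f ((k : ℝ) / K)
  obtain ⟨B, hB0, hB⟩ : ∃ B : ℝ, 0 < B ∧ ∀ k, |y k| ≤ B := by
    refine ⟨1 + ∑ k, |y k|, by positivity, fun k => ?_⟩
    have := Finset.single_le_sum (f := fun k => |y k|) (fun i _ => abs_nonneg _) (Finset.mem_univ k)
    linarith
  let s : Fin K → ℝ := fun k => (y k + B) / (2 * B)
  set η := min 1 (ε / (4 * B)) with hη
  have hη0 : 0 < η := by positivity
  have hη1 : η ≤ 1 := min_le_left _ _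
  have hηε : 2 * B * η ≤ ε / 2 := by
    calc 2 * B * η ≤ 2 * B * (ε / (4 * B)) := by gcongr; exact min_le_right _ _
      _ = ε / 2 := by field_simp; norm_num
  have hpi := Real.pi_pos
  obtain ⟨w, hw⟩ := kronecker (fun k : Fin K => ρ ((α + β) / 2 + ((k : ℝ) + 1) * w₀)) s hw₀
    (Real.cos (Real.pi * η / 2))
    (Real.cos_nonneg_of_neg_pi_div_two_le_of_le (by nlinarith) (by nlinarith))
    (by
      have := Real.cos_lt_cos_of_nonneg_of_le_pi (x := 0) (y := Real.pi * η / 2) le_rfl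
        (by nlinarith) (by positivity)
      simpa using this)
  refine ⟨2 * B, -B, w, w₀, fun x hx => ?_⟩
  simp only [mem_iUnion, Finset.mem_range] at hx
  obtain ⟨k, hk, hx1, hx2⟩ := hx
  rw [div_le_iff₀ (by positivity)] at hx1
  rw [le_div_iff₀ (by positivity)] at hx2
  have hpsi : psiFun (2 * K * x) / 2 + 1 = (k : ℝ) + 1 := by
    have := triWave_of_mem k (2 * K * x - 2 * k) (by linarith) (by linarith)
    have e : 2 * ((k : ℤ) : ℝ) + (2 * K * x - 2 * k) = 2 * K * x := by push_cast; ring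
    rw [e] at this
    rw [psiFun, this]; ring
  rw [hpsi]
  have hwk := hw ⟨k, hk⟩
  obtain ⟨m, hm⟩ := close_of_cos _ η hη0 hwk
  have hyB := abs_le.1 (hB ⟨k, hk⟩)
  have hs0 : 0 ≤ s ⟨k, hk⟩ := div_nonneg (by linarith) (by linarith)
  have hs1 : s ⟨k, hk⟩ ≤ 1 := by
    simp only [s]
    rw [div_le_one (by positivity)]; linarith
  have hts := triWave_of_mem 0 _ hs0 hs1
  simp only [Int.cast_zero, mul_zero, zero_add] at hts
  have hlip := triWave_lip _ _ m |>.trans_lt hm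
  rw [hts] at hlip
  simp only at hlip
  set g := triWave (w * ρ ((α + β) / 2 + ((k : ℝ) + 1) * w₀)) with hg
  have hys : y ⟨k, hk⟩ = 2 * B * s ⟨k, hk⟩ - B := by
    simp only [s]; field_simp; ring
  have h1 : |2 * B * g + -B - y ⟨k, hk⟩| < ε / 2 := by
    have : 2 * B * g + -B - y ⟨k, hk⟩ = 2 * B * (g - s ⟨k, hk⟩) := by rw [hys]; ring
    rw [this, abs_mul, abs_of_pos (by positivity : 0 < 2 * B)]
    exact lt_of_lt_of_le (by gcongr) hηε
  have hkK : (k : ℝ) + 1 ≤ K := by exact_mod_cast hk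
  have h2 : |y ⟨k, hk⟩ - f x| < ε / 2 := by
    apply hf
    · constructor
      · positivity
      · rw [div_le_one hKr]; simp only; linarith
    · have hk0 : (0 : ℝ) ≤ k := by positivity
      constructor
      · by_contra hc
        push Not at hc
        nlinarith
      · by_contra hc
        push Not at hc
        nlinarith
    · simp only
      have : (k : ℝ) / K - x = (k - K * x) / K := by field_simp
      rw [this, abs_div, abs_of_pos hKr]
      gcongr
      rw [abs_lt]; constructor <;> linarith
  have h3 := abs_add_le (2 * B * g + -B - y ⟨k, hk⟩) (y ⟨k, hk⟩ - f x)
  have h4 : 2 * B * g + -B - y ⟨k, hk⟩ + (y ⟨k, hk⟩ - f x) = 2 * B * g + -B - f x := by ring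
  rw [h4] at h3
  linarith
end

section
/- For every positive integer d, there exist continuous functions h_{i,j} : [0,1] → ℝ for i = 0, 1, …, 2d and j = 1, 2, …, d such that: for every continuous function f : [0,1]^d → ℝ there exist continuous functions g_i : ℝ → ℝ, i = 0, 1, …, 2d, with f(x_1, …, x_d) = Σ_{i=0}^{2d} g_i( Σ_{j=1}^{d} h_{i,j}(x_j) ) for all (x_1, …, x_d) ∈ [0,1]^d. -/
open Set
open scoped unitInterval BoundedContinuousFunction


theorem iter {E F : Type*} [NormedAddCommGroup E] [NormedSpace ℝ E] [CompleteSpace E]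
    [NormedAddCommGroup F] [NormedSpace ℝ F] (T : E →L[ℝ] F) (C θ : ℝ) (hθ0 : 0 ≤ θ) (hθ : θ < 1)
    (hC : 0 ≤ C)
    (h : ∀ f : F, ∃ g : E, ‖g‖ ≤ C * ‖f‖ ∧ ‖f - T g‖ ≤ θ * ‖f‖) : Function.Surjective T := by
  intro f
  choose G hG1 hG2 using h
  let r : ℕ → F := fun k => (fun u => u - T (G u))^[k] f
  have hr : ∀ k, r (k+1) = r k - T (G (r k)) := fun k => by
    simp only [r, Function.iterate_succ_apply']
  have hrn : ∀ k, ‖r k‖ ≤ θ ^ k * ‖f‖ := by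
    intro k
    induction k with
    | zero => simp [r]
    | succ k ih =>
      rw [hr]
      refine (hG2 _).trans ?_
      calc θ * ‖r k‖ ≤ θ * (θ ^ k * ‖f‖) := by gcongr
        _ = _ := by ring
  have hs : Summable (fun k => G (r k)) := by
    refine Summable.of_norm_bounded (g := fun k => θ ^ k * (C * ‖f‖))
      ((summable_geometric_of_lt_one hθ0 hθ).mul_right _) (fun k => ?_)
    calc ‖G (r k)‖ ≤ C * ‖r k‖ := hG1 _
      _ ≤ C * (θ ^ k * ‖f‖) := by gcongr; exact hrn k
      _ = _ := by ring
  have hr0 : Filter.Tendsto r Filter.atTop (nhds 0) := by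
    refine squeeze_zero_norm hrn ?_
    simpa using (tendsto_pow_atTop_nhds_zero_of_lt_one hθ0 hθ).mul_const ‖f‖
  have hsum : ∀ k, T (∑ m ∈ Finset.range k, G (r m)) = f - r k := by
    intro k
    induction k with
    | zero => simp [r]
    | succ k ih => rw [Finset.sum_range_succ, map_add, ih, hr]; abel
  refine ⟨∑' k, G (r k), ?_⟩
  have h1 := (T.continuous.tendsto _).comp hs.hasSum.tendsto_sum_nat
  have h2 : Filter.Tendsto (fun k => f - r k) Filter.atTop (nhds f) := by
    simpa using tendsto_const_nhds.sub hr0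
  refine tendsto_nhds_unique h1 (h2.congr fun k => (hsum k).symm)

/-- staircase -/
theorem stair (n : ℕ) (hn : 0 < n) (ε : ℝ) (hε : 0 < ε) :
    ∃ (P : Set I) (φ : Fin n → C(I, I)), P.Finite ∧ (∀ i x, dist (φ i x) x < ε) ∧
      ∀ x i i', φ i x ∉ P → φ i' x ∉ P → i = i' := by
  have hn' : (0:ℝ) < n := by exact_mod_cast hn
  have hn1 : (1:ℝ) ≤ n := by exact_mod_cast hn
  obtain ⟨N, hN⟩ := exists_nat_gt (2 / ε)
  have hN0 : (0:ℝ) < N := lt_trans (by positivity) hN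
  let u : ℝ → ℝ := fun y => min 1 (n * y) - y
  have hu : Continuous (fun x : ℝ => u (Int.fract x)) := by
    have h := ContinuousOn.comp_fract (s := fun x : ℝ => x) (f := fun _ : ℝ => u)
      (by apply Continuous.continuousOn; simp only [u, Function.uncurry_def]; fun_prop)
      continuous_id (by intro _; simp [u, hn1])
    exact h
  let s : ℝ → ℝ := fun x => x + u (Int.fract x)
  have hsc : Continuous s := continuous_id.add hu
  have hsd : ∀ x, |s x - x| ≤ 1 := by
    intro x
    have h0 := Int.fract_nonneg x
    have h1 := Int.fract_lt_one x
    simp only [s, u, add_sub_cancel_left]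
    have : 0 ≤ min 1 (n * Int.fract x) := le_min zero_le_one (by positivity)
    have h3 : min 1 (n * Int.fract x) ≤ 1 := min_le_left _ _
    rw [abs_le]; constructor <;> linarith
  have hsg : ∀ x : ℝ, 1 ≤ n * Int.fract x → s x = ((⌊x⌋ + 1 : ℤ) : ℝ) := by
    intro x hx
    simp only [s, u, min_eq_left hx]
    have := Int.floor_add_fract x
    push_cast; linarith
  let φ : Fin n → C(I, I) := fun i =>
    ⟨fun x => projIcc 0 1 zero_le_one (s (N * x - i / n) / N), by
      refine continuous_projIcc.comp ?_
      have : Continuous fun x : I => (N * (x:ℝ) - i / n) := by fun_prop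
      exact (hsc.comp this).div_const _⟩
  refine ⟨(fun k : ℕ => projIcc (0:ℝ) 1 zero_le_one (k / N)) '' (Iic N), φ,
    (Set.finite_Iic N).image _, ?_, ?_⟩
  · intro i x
    have hi : (i : ℝ) / n ≤ 1 := by
      rw [div_le_one hn']; exact_mod_cast i.2.le
    have hi0 : 0 ≤ (i : ℝ) / n := by positivity
    have h1 : dist (φ i x) x ≤ |s (N * x - i / n) / N - x| := by
      have hp := abs_projIcc_sub_projIcc (α := ℝ) (c := s (N * x - i / n) / N) (d := x) zero_le_one
      rw [projIcc_val] at hp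
      exact hp
    refine h1.trans_lt ?_
    have h2 := abs_le.1 (hsd (N * x - i / n))
    have h3 : |s (N * x - i / n) / N - x| ≤ 2 / N := by
      have : s (N * x - i / n) / N - x = (s (N * x - i / n) - N * x) / N := by field_simp
      rw [this, abs_div, abs_of_pos hN0]
      gcongr
      rw [abs_le]; constructor <;> linarith
    refine h3.trans_lt ?_
    rw [div_lt_iff₀ hε] at hN
    rw [div_lt_iff₀ hN0]; linarith
  · have key : ∀ i x, φ i x ∉ (fun k : ℕ => projIcc (0:ℝ) 1 zero_le_one (k / N)) '' (Iic N) →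
        n * Int.fract (N * (x:ℝ) - i / n) < 1 := by
      intro i x h
      by_contra! hc
      apply h
      have := hsg _ hc
      set m : ℤ := ⌊(N * (x:ℝ) - i / n)⌋ + 1
      have hφ : φ i x = projIcc 0 1 zero_le_one ((m:ℝ) / N) := by
        simp only [φ, ContinuousMap.coe_mk, this]
      rw [hφ]
      clear_value m
      rcases le_total m 0 with hm | hm
      · refine ⟨0, by simp, ?_⟩
        have : (m:ℝ) / N ≤ 0 := div_nonpos_of_nonpos_of_nonneg (by exact_mod_cast hm) hN0.le
        simp [projIcc_of_le_left _ this]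
      · lift m to ℕ using hm
        rcases le_total m N with hm | hm
        · exact ⟨m, hm, by simp⟩
        · refine ⟨N, by simp, ?_⟩
          have : 1 ≤ (m:ℝ) / N := by rw [one_le_div hN0]; exact_mod_cast hm
          have h2 : 1 ≤ (N:ℝ) / N := by rw [one_le_div hN0]
          simp only [Int.cast_natCast]
          rw [projIcc_of_right_le _ this, projIcc_of_right_le _ h2]
    intro x i i' h h'
    have h1 := key _ _ h
    have h2 := key _ _ h'
    have p1 := Int.fract_nonneg (N * (x:ℝ) - i / n)
    have p2 := Int.fract_nonneg (N * (x:ℝ) - i' / n)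
    have e1 := Int.floor_add_fract (N * (x:ℝ) - i / n)
    have e2 := Int.floor_add_fract (N * (x:ℝ) - i' / n)
    generalize ⌊(N * (x:ℝ) - i / n)⌋ = a at *
    generalize ⌊(N * (x:ℝ) - i' / n)⌋ = b at *
    generalize Int.fract (N * (x:ℝ) - i / n) = α at *
    generalize Int.fract (N * (x:ℝ) - i' / n) = β at *
    have e : n * α - n * β = (((i':ℤ) - (i:ℤ) - n * (a - b) : ℤ) : ℝ) := by
      have q1 : (n:ℝ) * (i / n) = i := by field_simp
      have q2 : (n:ℝ) * (i' / n) = i' := by field_simp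
      push_cast
      have : n * (a + α) - n * (b + β) = (i':ℝ) - i := by rw [e1, e2]; linarith
      linarith
    have w1 : 0 ≤ n * α := by positivity
    have w2 : 0 ≤ n * β := by positivity
    have l1 : (((i':ℤ) - (i:ℤ) - n * (a - b) : ℤ) : ℝ) < (1:ℤ) := by rw [← e]; push_cast; linarith
    have l2 : ((-1 : ℤ):ℝ) < (((i':ℤ) - (i:ℤ) - n * (a - b) : ℤ) : ℝ) := by
      rw [← e]; push_cast; linarith
    have l1 := Int.cast_lt.1 l1
    have l2 := Int.cast_lt.1 l2
    have hz : (i':ℤ) - i = n * (a - b) := by linarith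
    have hab : a - b = 0 := by
      have := i.2
      have := i'.2
      by_contra hne
      rcases lt_or_gt_of_ne hne with hlt | hgt
      · have : (n:ℤ) * (a - b) ≤ n * (-1) := by gcongr; linarith
        omega
      · have : (n:ℤ) * 1 ≤ n * (a - b) := by gcongr; linarith
        omega
    rw [hab] at hz
    ext; omega

theorem lin_inj (d : ℕ) (S : Set (Fin d → ℝ)) (hS : S.Finite) :
    ∃ l : Fin d → ℝ, InjOn (fun p => ∑ j, l j * p j) S := by
  let q : (Fin d → ℝ) × (Fin d → ℝ) → Polynomial ℝ := fun z =>
    ∑ j : Fin d, Polynomial.C (z.1 j - z.2 j) * Polynomial.X ^ (j:ℕ)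
  have hfin : (⋃ z ∈ (S ×ˢ S), {t | t ∈ (q z).roots}).Finite := by
    refine (hS.prod hS).biUnion fun z _ => ?_
    exact (q z).roots.finite_toSet
  obtain ⟨t, ht⟩ := hfin.infinite_compl.nonempty
  refine ⟨fun j => t ^ (j:ℕ), fun p hp p' hp' h => ?_⟩
  by_contra hne
  apply ht
  simp only [mem_iUnion]
  refine ⟨(p, p'), ⟨hp, hp'⟩, ?_⟩
  rw [Set.mem_ofPred, Polynomial.mem_roots']
  constructor
  · intro h0
    apply hne
    ext j
    have := congrArg (fun r => Polynomial.coeff r (j:ℕ)) h0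
    simp only [q, Polynomial.finsetSum_coeff, Polynomial.coeff_C_mul_X_pow, Fin.val_inj,
      Polynomial.coeff_zero, Finset.sum_ite_eq, Finset.mem_univ, if_true] at this
    exact sub_eq_zero.1 this
  · simp only [Polynomial.IsRoot, q, Polynomial.eval_finsetSum]
    simp only [Polynomial.eval_mul, Polynomial.eval_C, Polynomial.eval_pow, Polynomial.eval_X]
    simp only at h
    rw [← sub_eq_zero, ← Finset.sum_sub_distrib] at h
    rw [← h]
    exact Finset.sum_congr rfl fun j _ => by ring

theorem perturb (d : ℕ) (P : Set I) (hP : P.Finite) (Q : Fin d → C(I, ℝ)) (δ : ℝ) (hδ : 0 < δ) :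
    ∃ Q' : Fin d → C(I, ℝ), (∀ j x, dist (Q' j x) (Q j x) < δ) ∧
      InjOn (fun p : Fin d → I => ∑ j, Q' j (p j)) {p | ∀ j, p j ∈ P} := by
  have hK : {p : Fin d → I | ∀ j, p j ∈ P}.Finite := by
    have := Set.Finite.pi (fun _ : Fin d => hP)
    refine this.subset fun p hp => ?_
    simpa using hp
  set K := {p : Fin d → I | ∀ j, p j ∈ P}
  obtain ⟨l, hl⟩ := lin_inj d ((fun (p : Fin d → I) j => (p j : ℝ)) '' K) (hK.image _)
  let A : (Fin d → I) → ℝ := fun p => ∑ j, Q j (p j)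
  let B : (Fin d → I) → ℝ := fun p => ∑ j, l j * (p j : ℝ)
  have hB : InjOn B K := by
    intro p hp p' hp' h
    have := hl ⟨p, hp, rfl⟩ ⟨p', hp', rfl⟩ h
    ext j
    exact congrFun this j
  have hfin : ((fun z : (Fin d → I) × (Fin d → I) => (A z.2 - A z.1) / (B z.1 - B z.2)) ''
    (K ×ˢ K)).Finite := (hK.prod hK).image _
  let M : ℝ := ∑ j, |l j| + 1
  have hM : 0 < M := by positivity
  have hinf : (Ioo 0 (δ / M)).Infinite := Ioo_infinite (by positivity)
  obtain ⟨t, ⟨ht0, ht1⟩, ht⟩ := (hinf.sdiff hfin).nonempty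
  refine ⟨fun j => ⟨fun x => Q j x + t * (l j * (x:ℝ)), by fun_prop⟩, ?_, ?_⟩
  · intro j x
    simp only [ContinuousMap.coe_mk, Real.dist_eq, add_sub_cancel_left, abs_mul, abs_of_pos ht0]
    have h1 : |l j| ≤ ∑ j, |l j| :=
      Finset.single_le_sum (f := fun j => |l j|) (fun _ _ => abs_nonneg _) (Finset.mem_univ j)
    have h2 : |(x:ℝ)| ≤ 1 := by rw [abs_of_nonneg x.2.1]; exact x.2.2
    rw [lt_div_iff₀ hM] at ht1
    calc t * (|l j| * |(x:ℝ)|) ≤ t * (M * 1) := by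
          gcongr
          exact h1.trans (by simp [M])
      _ < δ := by linarith
  · intro p hp p' hp' h
    by_contra hne
    apply ht
    refine ⟨(p, p'), ⟨hp, hp'⟩, ?_⟩
    have hBne : B p - B p' ≠ 0 := sub_ne_zero.2 fun hh => hne (hB hp hp' hh)
    simp only [ContinuousMap.coe_mk, Finset.sum_add_distrib, ← Finset.mul_sum] at h
    change A p + t * B p = A p' + t * B p' at h
    simp only
    rw [div_eq_iff hBne]; linarith

/-- The inner sum. -/
noncomputable def inner' {n d : ℕ} (h : Fin n → Fin d → C(I, ℝ)) (i : Fin n) : C(Fin d → I, ℝ) :=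
  ∑ j, (h i j).comp ⟨fun x => x j, continuous_apply j⟩

theorem inner'_apply {n d : ℕ} (h : Fin n → Fin d → C(I, ℝ)) (i : Fin n) (x : Fin d → I) :
    inner' h i x = ∑ j, h i j (x j) := by
  simp [inner', ContinuousMap.sum_apply]

theorem approx (d : ℕ) (f : C(Fin d → I, ℝ)) (h0 : Fin (2 * d + 1) → Fin d → C(I, ℝ))
    (δ η : ℝ) (hδ : 0 < δ) (hη : 0 < η) :
    ∃ h : Fin (2 * d + 1) → Fin d → C(I, ℝ), dist h h0 < δ ∧
      ∃ g : Fin (2 * d + 1) → (ℝ →ᵇ ℝ), (∀ i, ‖g i‖ ≤ ‖f‖) ∧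
        ∀ x, |f x - ∑ i, g i (inner' h i x)| ≤ (2 * d / (2 * d + 1 : ℝ)) * ‖f‖ + η := by
  -- moduli of continuity
  obtain ⟨ε₁, hε₁, hf⟩ := Metric.uniformContinuous_iff.1
    (CompactSpace.uniformContinuous_of_continuous f.continuous) η hη
  have hh0 : ∃ ε > 0, ∀ i j x y, dist x y < ε → dist (h0 i j x) (h0 i j y) < δ / 4 := by
    have : ∀ z : Fin (2 * d + 1) × Fin d, ∀ᶠ ε in nhdsWithin (0:ℝ) (Ioi 0),
        ∀ x y, dist x y < ε → dist (h0 z.1 z.2 x) (h0 z.1 z.2 y) < δ / 4 := by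
      intro z
      obtain ⟨ε, hε, hz⟩ := Metric.uniformContinuous_iff.1
        (CompactSpace.uniformContinuous_of_continuous (h0 z.1 z.2).continuous) (δ/4) (by positivity)
      filter_upwards [Ioo_mem_nhdsGT hε] with e he x y hxy
      exact hz (hxy.trans he.2)
    have h2 := (Filter.eventually_all.2 this).and self_mem_nhdsWithin
    obtain ⟨ε, h3, h4⟩ := h2.exists
    exact ⟨ε, h4, fun i j => h3 (i, j)⟩
  obtain ⟨ε₂, hε₂, hh⟩ := hh0
  obtain ⟨P, φ, hP, hφd, hφ⟩ := stair (2 * d + 1) (by positivity) (min ε₁ ε₂) (by positivity)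
  choose Q hQd hQi using fun i => perturb d P hP (h0 i) (δ / 4) (by positivity)
  let h : Fin (2 * d + 1) → Fin d → C(I, ℝ) := fun i j => (Q i j).comp (φ i)
  have hn : (0:ℝ) < 2 * d + 1 := by positivity
  have hK : {p : Fin d → I | ∀ j, p j ∈ P}.Finite := by
    have := Set.Finite.pi (fun _ : Fin d => hP)
    refine this.subset fun p hp => ?_
    simpa using hp
  have hg : ∀ i, ∃ g : ℝ →ᵇ ℝ, ‖g‖ ≤ ‖f‖ / (2 * d + 1) ∧
      ∀ p : Fin d → I, (∀ j, p j ∈ P) → g (∑ j, Q i j (p j)) = f p / (2 * d + 1) := by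
    intro i
    have : Finite {p : Fin d → I | ∀ j, p j ∈ P} := hK
    let e : {p : Fin d → I | ∀ j, p j ∈ P} → ℝ := fun p => ∑ j, Q i j (p.1 j)
    have he : Topology.IsClosedEmbedding e := by
      refine Continuous.isClosedEmbedding (by fun_prop) ?_
      exact (hQi i).injective
    let F : {p : Fin d → I | ∀ j, p j ∈ P} →ᵇ ℝ :=
      BoundedContinuousFunction.mkOfCompact ⟨fun p => f p.1 / (2 * d + 1), by fun_prop⟩
    obtain ⟨g, hg1, hg2⟩ :=
      BoundedContinuousFunction.exists_extension_norm_eq_of_isClosedEmbedding F he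
    refine ⟨g, ?_, fun p hp => congrFun hg2 ⟨p, hp⟩⟩
    rw [hg1]
    refine (BoundedContinuousFunction.norm_le (by positivity)).2 fun p => ?_
    simp only [F, BoundedContinuousFunction.mkOfCompact_apply, ContinuousMap.coe_mk, norm_div]
    rw [Real.norm_of_nonneg hn.le]
    gcongr
    exact f.norm_coe_le_norm _
  choose g hg1 hg2 using hg
  refine ⟨h, ?_, g, fun i => (hg1 i).trans ?_, fun x => ?_⟩
  · refine lt_of_le_of_lt ?_ (show δ / 2 < δ by linarith)
    refine (dist_pi_le_iff (by positivity)).2 fun i => (dist_pi_le_iff (by positivity)).2 fun j => ?_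
    refine (ContinuousMap.dist_le (by positivity)).2 fun x => ?_
    have a1 := hQd i j (φ i x)
    have a2 := hh i j (φ i x) x ((hφd i x).trans_le (min_le_right _ _))
    have a3 := dist_triangle (Q i j (φ i x)) (h0 i j (φ i x)) (h0 i j x)
    simp only [h, ContinuousMap.comp_apply]
    linarith
  · refine div_le_self (norm_nonneg _) ?_
    have : (0:ℝ) ≤ d := by positivity
    linarith
  · classical
    have e1 : f x - ∑ i, g i (inner' h i x) =
        ∑ i : Fin (2 * d + 1), (f x / (2 * d + 1) - g i (inner' h i x)) := by
      rw [Finset.sum_sub_distrib]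
      simp
      field_simp
    rw [e1]
    let bad : Finset (Fin (2 * d + 1)) := Finset.univ.filter fun i => ∃ j, φ i (x j) ∉ P
    have hbad : bad.card ≤ d := by
      have : ∀ i : bad, ∃ j, φ i.1 (x j) ∉ P := fun i => (Finset.mem_filter.1 i.2).2
      choose J hJ using this
      have hinj : Function.Injective J := by
        intro i i' hii
        refine Subtype.ext (hφ (x (J i)) _ _ (hJ i) ?_)
        rw [hii]; exact hJ i'
      simpa using Fintype.card_le_of_injective J hinj
    have hterm : ∀ i, |f x / (2 * d + 1) - g i (inner' h i x)| ≤
        η / (2 * d + 1) + if i ∈ bad then 2 * ‖f‖ / (2 * d + 1) else 0 := by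
      intro i
      split_ifs with hi
      · have b1 : |f x / (2 * d + 1)| ≤ ‖f‖ / (2 * d + 1) := by
          rw [abs_div, abs_of_pos hn]; gcongr; exact f.norm_coe_le_norm x
        have b2 : |g i (inner' h i x)| ≤ ‖f‖ / (2 * d + 1) :=
          ((g i).norm_coe_le_norm _).trans (hg1 i)
        have b3 := abs_sub (f x / (2 * d + 1)) (g i (inner' h i x))
        have b4 : 0 ≤ η / (2 * d + 1) := by positivity
        have b5 : 2 * ‖f‖ / (2 * d + 1) = ‖f‖ / (2 * d + 1) + ‖f‖ / (2 * d + 1) := by ring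
        linarith
      · have hi' : ∀ j, φ i (x j) ∈ P := by
          simpa [bad] using hi
        have := hg2 i (fun j => φ i (x j)) hi'
        rw [inner'_apply]
        simp only [h, ContinuousMap.comp_apply]
        rw [this, ← sub_div, abs_div, abs_of_pos hn, add_zero]
        gcongr
        rw [← Real.dist_eq, dist_comm]
        refine (hf ?_).le
        refine (dist_pi_lt_iff hε₁).2 fun j => (hφd i (x j)).trans_le (min_le_left _ _)
    refine (Finset.abs_sum_le_sum_abs _ _).trans ((Finset.sum_le_sum fun i _ => hterm i).trans ?_)
    rw [Finset.sum_add_distrib, Finset.sum_ite_mem, Finset.univ_inter, Finset.sum_const,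
      Finset.sum_const]
    simp only [Finset.card_univ, Fintype.card_fin, nsmul_eq_mul]
    have c1 : ((2 * d + 1 : ℕ) : ℝ) * (η / (2 * d + 1)) = η := by push_cast; field_simp
    have c2 : (bad.card : ℝ) * (2 * ‖f‖ / (2 * d + 1)) ≤ d * (2 * ‖f‖ / (2 * d + 1)) := by
      gcongr
    have c3 : d * (2 * ‖f‖ / (2 * d + 1)) = 2 * d / (2 * d + 1) * ‖f‖ := by ring
    linarith

/-- Outer operator. -/
noncomputable def outer {n d : ℕ} (h : Fin n → Fin d → C(I, ℝ)) :
    (Fin n → (ℝ →ᵇ ℝ)) →L[ℝ] C(Fin d → I, ℝ) :=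
  LinearMap.mkContinuous
    { toFun := fun g => ∑ i, (g i).toContinuousMap.comp (inner' h i)
      map_add' := fun g g' => by
        ext x; simp [ContinuousMap.sum_apply, Finset.sum_add_distrib]
      map_smul' := fun c g => by
        ext x; simp [ContinuousMap.sum_apply, Finset.mul_sum] } n (fun g => by
        refine (norm_sum_le (Finset.univ : Finset (Fin n))
          (fun i => (g i).toContinuousMap.comp (inner' h i))).trans ?_
        calc ∑ i : Fin n, ‖(g i).toContinuousMap.comp (inner' h i)‖ ≤ ∑ i : Fin n, ‖g‖ := by
              refine Finset.sum_le_sum fun i _ => ?_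
              refine (ContinuousMap.norm_le _ (norm_nonneg _)).2 fun x => ?_
              exact ((g i).norm_coe_le_norm _).trans (norm_le_pi_norm g i)
          _ = _ := by simp)

theorem outer_eq {n d : ℕ} (h : Fin n → Fin d → C(I, ℝ)) (g : Fin n → (ℝ →ᵇ ℝ)) :
    outer h g = ∑ i, (g i).toContinuousMap.comp (inner' h i) := rfl

theorem outer_apply {n d : ℕ} (h : Fin n → Fin d → C(I, ℝ)) (g : Fin n → (ℝ →ᵇ ℝ))
    (x : Fin d → I) : outer h g x = ∑ i, g i (∑ j, h i j (x j)) := by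
  rw [outer_eq, ContinuousMap.sum_apply]
  simp [inner'_apply]

theorem continuous_inner' {n d : ℕ} (i : Fin n) :
    Continuous fun h : Fin n → Fin d → C(I, ℝ) => inner' h i := by
  unfold inner'
  refine continuous_finsetSum _ fun j _ => ?_
  exact (ContinuousMap.continuous_precomp _).comp
    ((continuous_apply j).comp (continuous_apply i))

theorem continuous_outer {n d : ℕ} (g : Fin n → (ℝ →ᵇ ℝ)) :
    Continuous fun h : Fin n → Fin d → C(I, ℝ) => outer h g := by
  simp only [outer_eq]
  refine continuous_finsetSum _ fun i _ => ?_
  exact (ContinuousMap.continuous_postcomp _).comp (continuous_inner' i)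

theorem exists_good (d : ℕ) : ∃ h : Fin (2 * d + 1) → Fin d → C(I, ℝ),
    Function.Surjective (outer h) := by
  let D := TopologicalSpace.denseSeq C(Fin d → I, ℝ)
  let θ : ℝ := 2 * d / (2 * d + 1 : ℝ)
  have hθ0 : 0 ≤ θ := by positivity
  have hθ1 : θ < 1 := by
    simp only [θ]
    rw [div_lt_one (by positivity)]; linarith
  let U : ℕ × ℕ → Set (Fin (2 * d + 1) → Fin d → C(I, ℝ)) := fun m =>
    {h | ∃ g : Fin (2 * d + 1) → (ℝ →ᵇ ℝ), (∀ i, ‖g i‖ ≤ ‖D m.1‖) ∧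
      ‖D m.1 - outer h g‖ < θ * ‖D m.1‖ + 1 / (m.2 + 1 : ℝ)}
  have hUo : ∀ m, IsOpen (U m) := by
    intro m
    have : U m = ⋃ g : Fin (2 * d + 1) → (ℝ →ᵇ ℝ), ⋃ _ : (∀ i, ‖g i‖ ≤ ‖D m.1‖),
        {h | ‖D m.1 - outer h g‖ < θ * ‖D m.1‖ + 1 / (m.2 + 1 : ℝ)} := by
      ext h; simp [U]
    rw [this]
    refine isOpen_iUnion fun g => isOpen_iUnion fun _ => ?_
    exact isOpen_lt (continuous_const.sub (continuous_outer g)).norm continuous_const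
  have hUd : ∀ m, Dense (U m) := by
    intro m
    rw [Metric.dense_iff]
    intro h0 δ hδ
    have hp : (0:ℝ) < 1 / (m.2 + 1 : ℝ) := by positivity
    obtain ⟨h, hd, g, hg, hx⟩ := approx d (D m.1) h0 δ (1 / (m.2 + 1 : ℝ) / 2) hδ (by positivity)
    refine ⟨h, hd, g, hg, ?_⟩
    refine lt_of_le_of_lt ((ContinuousMap.norm_le _ (by positivity)).2 fun x => ?_)
      (show θ * ‖D m.1‖ + 1 / (m.2 + 1 : ℝ) / 2 < _ by linarith)
    have := hx x
    rw [ContinuousMap.sub_apply, Real.norm_eq_abs, outer_apply]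
    simpa only [inner'_apply] using this
  have hcomp : CompleteSpace (Fin (2 * d + 1) → Fin d → C(I, ℝ)) := inferInstance
  have : BaireSpace (Fin (2 * d + 1) → Fin d → C(I, ℝ)) :=
    @BaireSpace.of_completelyPseudoMetrizable _ _
      TopologicalSpace.IsCompletelyPseudoMetrizableSpace.of_completeSpace_pseudometrizable
  obtain ⟨h, hh⟩ := (dense_iInter_of_isOpen hUo hUd).nonempty
  refine ⟨h, iter _ 2 ((1 + θ) / 2) (by positivity) (by linarith) (by norm_num) fun f => ?_⟩
  by_cases hf0 : f = 0
  · exact ⟨0, by simp [hf0]⟩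
  have hf : 0 < ‖f‖ := norm_pos_iff.2 hf0
  let ε := (1 - θ) / 6 * ‖f‖
  have hε : 0 < ε := mul_pos (by linarith) hf
  obtain ⟨m, hm⟩ : ∃ m, dist f (D m) < ε :=
    (TopologicalSpace.denseRange_denseSeq C(Fin d → I, ℝ)).exists_dist_lt f hε
  obtain ⟨k, hk⟩ := exists_nat_one_div_lt hε
  obtain ⟨g, hg1, hg2⟩ := mem_iInter.1 hh (m, k)
  simp only at hg1 hg2
  rw [dist_eq_norm] at hm
  have hDm : ‖D m‖ ≤ ‖f‖ + ε := by
    have := norm_sub_norm_le (D m) f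
    rw [norm_sub_rev] at this
    linarith
  refine ⟨g, (pi_norm_le_iff_of_nonneg (by positivity)).2 fun i => (hg1 i).trans ?_, ?_⟩
  · have : ε ≤ 1 * ‖f‖ := by
      simp only [ε]; gcongr; linarith
    linarith
  · have t1 : ‖f - outer h g‖ ≤ ‖f - D m‖ + ‖D m - outer h g‖ := norm_sub_le_norm_sub_add_norm_sub _ _ _
    have t2 : θ * ‖D m‖ ≤ θ * ‖f‖ + 1 * ε := by
      calc θ * ‖D m‖ ≤ θ * (‖f‖ + ε) := by gcongr
        _ = θ * ‖f‖ + θ * ε := by ring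
        _ ≤ _ := by gcongr
    have t3 : 3 * ε = (1 - θ) / 2 * ‖f‖ := by simp only [ε]; ring
    calc ‖f - outer h g‖ ≤ θ * ‖f‖ + 3 * ε := by linarith
      _ = _ := by rw [t3]; ring

theorem kolmogorov_superposition (d : ℕ) (hd : 0 < d) :
    ∃ h : Fin (2 * d + 1) → Fin d → ℝ → ℝ,
      (∀ i j, ContinuousOn (h i j) (Icc (0 : ℝ) 1)) ∧
      ∀ f : (Fin d → ℝ) → ℝ, ContinuousOn f (Icc (0 : Fin d → ℝ) 1) →
        ∃ g : Fin (2 * d + 1) → ℝ → ℝ,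
          (∀ i, Continuous (g i)) ∧
          ∀ x ∈ Icc (0 : Fin d → ℝ) 1,
            f x = ∑ i : Fin (2 * d + 1), g i (∑ j : Fin d, h i j (x j)) := by
  obtain ⟨h, hh⟩ := exists_good d
  refine ⟨fun i j => IccExtend zero_le_one (h i j), fun i j =>
    ((h i j).continuous.Icc_extend').continuousOn, fun f hf => ?_⟩
  obtain ⟨g, hg⟩ := hh ⟨fun x => f (fun j => (x j : ℝ)), by
    refine hf.comp_continuous (by fun_prop) fun x => ?_
    exact ⟨fun j => (x j).2.1, fun j => (x j).2.2⟩⟩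
  refine ⟨fun i => g i, fun i => (g i).continuous, fun x hx => ?_⟩
  have := congrArg (fun F => F (fun j => (⟨x j, hx.1 j, hx.2 j⟩ : I))) hg
  simp only [outer_apply, ContinuousMap.coe_mk] at this
  rw [← this]
  refine Finset.sum_congr rfl fun i _ => ?_
  congr 1
  refine Finset.sum_congr rfl fun j _ => ?_
  exact (IccExtend_of_mem zero_le_one (h i j) ⟨hx.1 j, hx.2 j⟩).symm
end
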